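/- arXiv:1907.09796 — 2 statements merged into one kernel-verified Lean document; each statement's English description precedes it below -/
import Mathlib

section
/- Let A_{-1}, A_0, A_1, G be as in the context, with G𝟙 = 𝟙, and let σ < 1 be a real number such that (A_{-1} − A_1)𝟙 ≥ (1 − σ)𝟙 entrywise. Define the sequence X : ℕ → B(ℓ∞) by X_0 = 0 and X_{k+1} = A_{-1} + A_0 X_k + A_1 X_k². Then for every k: (i) 0 ≤ X_k ≤ X_{k+1} ≤ G; (ii) ‖G − X_{k+1}‖ ≤ ‖A_0 + A_1 + A_1G‖ · ‖G − X_k‖; and (iii) ‖G − X_k‖ → 0 as k → ∞. -/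
open BoundedContinuousFunction Filter

noncomputable section

/-- ℓ∞: the Banach space of bounded real sequences with the sup norm. -/
abbrev Linf : Type := BoundedContinuousFunction ℕ ℝ

/-- A sequence is nonnegative if all its entries are nonnegative. -/
def vnonneg (x : Linf) : Prop := ∀ i, 0 ≤ x i

/-- An operator in B(ℓ∞) is positive if it maps nonnegative sequences to
nonnegative sequences. -/
def OpPos (A : Linf →L[ℝ] Linf) : Prop := ∀ x : Linf, vnonneg x → vnonneg (A x)

/-- The constant sequence with all entries equal to one. -/
def ones : Linf := BoundedContinuousFunction.const ℕ (1 : ℝ)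

namespace OpPos

variable {A B : Linf →L[ℝ] Linf}

theorem zero : OpPos 0 := fun _ _ _ => le_rfl

theorem add (hA : OpPos A) (hB : OpPos B) : OpPos (A + B) :=
  fun x hx i => add_nonneg (hA x hx i) (hB x hx i)

theorem mul (hA : OpPos A) (hB : OpPos B) : OpPos (A * B) :=
  fun x hx => hA _ (hB x hx)

/-- A positive operator is monotone. -/
theorem apply_le (hA : OpPos A) {x y : Linf} (hxy : ∀ i, x i ≤ y i) (i : ℕ) :
    A x i ≤ A y i := by
  have h := hA (y - x) (fun j => sub_nonneg.2 (hxy j)) i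
  rw [map_sub] at h
  exact sub_nonneg.1 h

/-- The norm of a positive operator is controlled by its value at `ones`. -/
theorem norm_le (hA : OpPos A) {c : ℝ} (hc : ∀ i, A ones i ≤ c) : ‖A‖ ≤ c := by
  have hc0 : 0 ≤ c := (hA ones (fun _ => zero_le_one) 0).trans (hc 0)
  refine A.opNorm_le_bound hc0 fun x => ?_
  refine (BoundedContinuousFunction.norm_le (by positivity)).2 fun i => ?_
  have hx : ∀ j, |x j| ≤ ‖x‖ := fun j => x.norm_coe_le_norm j
  have hbound : ‖x‖ * A ones i ≤ c * ‖x‖ := by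
    rw [mul_comm]
    exact mul_le_mul_of_nonneg_right (hc i) (norm_nonneg x)
  have hupper : A x i ≤ A (‖x‖ • ones) i :=
    hA.apply_le (fun j => by simpa [ones] using (abs_le.1 (hx j)).2) i
  have hlower : A (-(‖x‖ • ones)) i ≤ A x i :=
    hA.apply_le (fun j => by simpa [ones] using (abs_le.1 (hx j)).1) i
  simp only [map_neg, map_smul, BoundedContinuousFunction.coe_neg, Pi.neg_apply,
    BoundedContinuousFunction.coe_smul, smul_eq_mul] at hupper hlower
  rw [Real.norm_eq_abs, abs_le]
  constructor <;> linarith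

end OpPos

section Algebra

variable {V : Type*} [NormedAddCommGroup V] [NormedSpace ℝ V]

theorem recursion_sub_recursion (Am1 A0 A1 Y Z : V →L[ℝ] V) :
    (Am1 + A0 * Y + A1 * Y ^ 2) - (Am1 + A0 * Z + A1 * Z ^ 2) =
      A0 * (Y - Z) + A1 * (Y * (Y - Z) + (Y - Z) * Z) := by
  noncomm_ring

end Algebra

theorem norm_ones_le : ‖ones‖ ≤ 1 :=
  (BoundedContinuousFunction.norm_le zero_le_one).2 fun _ => by simp [ones]

/-- Fixed point iteration F₁: monotonic linear convergence starting from X₀ = 0. -/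
theorem stmt0
    (Am1 A0 A1 G : Linf →L[ℝ] Linf)
    (hAm1 : OpPos Am1) (hA0 : OpPos A0) (hA1 : OpPos A1) (hG : OpPos G)
    (hstoch : (Am1 + A0 + A1) ones = ones)
    (heq : A1 * G ^ 2 + A0 * G + Am1 = G)
    (hG1 : G ones = ones)
    (σ : ℝ) (hσ : σ < 1)
    (hgap : ∀ i, 1 - σ ≤ ((Am1 - A1) ones) i)
    (X : ℕ → Linf →L[ℝ] Linf)
    (hX0 : X 0 = 0)
    (hXrec : ∀ k, X (k + 1) = Am1 + A0 * X k + A1 * (X k) ^ 2) :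
    (∀ k, OpPos (X k) ∧ OpPos (X (k + 1) - X k) ∧ OpPos (G - X k)) ∧
    (∀ k, ‖G - X (k + 1)‖ ≤ ‖A0 + A1 + A1 * G‖ * ‖G - X k‖) ∧
    Tendsto (fun k => ‖G - X k‖) atTop (nhds 0) := by
  have hpos : ∀ k, OpPos (X k) := by
    intro k
    induction k with
    | zero => rw [hX0]; exact OpPos.zero
    | succ k ih =>
      rw [hXrec, pow_two]
      exact (hAm1.add (hA0.mul ih)).add (hA1.mul (ih.mul ih))
  have hmono : ∀ k, OpPos (X (k + 1) - X k) := by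
    intro k
    induction k with
    | zero => rw [hX0]; exact (sub_zero (X 1)).symm ▸ hpos 1
    | succ k ih =>
      have h := recursion_sub_recursion Am1 A0 A1 (X (k + 1)) (X k)
      rw [← hXrec, ← hXrec] at h
      rw [h]
      exact (hA0.mul ih).add (hA1.mul (((hpos _).mul ih).add (ih.mul (hpos k))))
  have herr : ∀ k, G - X (k + 1) =
      A0 * (G - X k) + A1 * (G * (G - X k) + (G - X k) * X k) := by
    intro k
    have hfix : Am1 + A0 * G + A1 * G ^ 2 = G := by
      calc Am1 + A0 * G + A1 * G ^ 2 = A1 * G ^ 2 + A0 * G + Am1 := by abel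
        _ = G := heq
    have h := recursion_sub_recursion Am1 A0 A1 G (X k)
    rwa [hfix, ← hXrec] at h
  have hle : ∀ k, OpPos (G - X k) := by
    intro k
    induction k with
    | zero => rw [hX0]; exact (sub_zero G).symm ▸ hG
    | succ k ih =>
      rw [herr]
      exact (hA0.mul ih).add (hA1.mul ((hG.mul ih).add (ih.mul (hpos k))))
  have hstep : ∀ k, ‖G - X (k + 1)‖ ≤ ‖A0 + A1 + A1 * G‖ * ‖G - X k‖ := by
    intro k
    refine (hle (k + 1)).norm_le fun i => ?_
    have hXone : ∀ j, X k ones j ≤ ones j := fun j => by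
      have h := hle k ones (fun _ => zero_le_one) j
      rw [_root_.sub_apply, hG1] at h
      exact sub_nonneg.1 h
    have hA1E := (hA1.mul (hle k)).apply_le hXone i
    have hval : (G - X (k + 1)) ones i ≤ (A0 + A1 + A1 * G) ((G - X k) ones) i := by
      rw [herr]
      generalize G - X k = E at hA1E ⊢
      simp only [_root_.add_apply, mul_apply_eq_comp, map_add,
        BoundedContinuousFunction.coe_add, Pi.add_apply] at hA1E ⊢
      linarith
    calc (G - X (k + 1)) ones i
        ≤ ‖(A0 + A1 + A1 * G) ((G - X k) ones)‖ :=
          hval.trans ((le_abs_self _).trans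
            (((A0 + A1 + A1 * G) ((G - X k) ones)).norm_coe_le_norm i))
      _ ≤ ‖A0 + A1 + A1 * G‖ * ‖(G - X k) ones‖ := ContinuousLinearMap.le_opNorm _ _
      _ ≤ ‖A0 + A1 + A1 * G‖ * ‖G - X k‖ := by
          gcongr
          exact (G - X k).unit_le_opNorm _ norm_ones_le
  have hC : ‖A0 + A1 + A1 * G‖ ≤ σ := by
    refine ((hA0.add hA1).add (hA1.mul hG)).norm_le fun i => ?_
    have hs : (Am1 + A0 + A1) ones i = 1 := by rw [hstoch]; rfl
    have hg := hgap i
    simp only [_root_.add_apply, _root_.sub_apply,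
      mul_apply_eq_comp, hG1, BoundedContinuousFunction.coe_add,
      BoundedContinuousFunction.coe_sub, Pi.add_apply, Pi.sub_apply] at hs hg ⊢
    linarith
  refine ⟨fun k => ⟨hpos k, hmono k, hle k⟩, hstep, ?_⟩
  have hσ0 : 0 ≤ σ := (norm_nonneg (A0 + A1 + A1 * G)).trans hC
  have hgeom : ∀ k, ‖G - X k‖ ≤ σ ^ k * ‖G‖ := by
    intro k
    induction k with
    | zero => rw [hX0, pow_zero, one_mul]; exact (congrArg norm (sub_zero G)).le
    | succ k ih =>
      calc ‖G - X (k + 1)‖ ≤ ‖A0 + A1 + A1 * G‖ * ‖G - X k‖ := hstep k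
        _ ≤ σ * (σ ^ k * ‖G‖) := by gcongr
        _ = σ ^ (k + 1) * ‖G‖ := by ring
  refine squeeze_zero (fun k => norm_nonneg (G - X k)) hgeom ?_
  simpa using (tendsto_pow_atTop_nhds_zero_of_lt_one hσ0 hσ).mul_const ‖G‖
end
end

section
/- Let R be a unital (not necessarily commutative) ring, let A_{-1}, A_0, A_1 ∈ R, and define L(X) := A_1X² + (A_0 − 1)X + A_{-1}. Let G ∈ R satisfy L(G) = 0, let X, Z ∈ R satisfy the Sylvester-type equation (A_1X + A_0 − 1)Z + A_1ZX = L(X), and set E := G − X and E' := G − (X − Z) = E + Z. Then (1 − A_0 − A_1X)E' − A_1E'X = A_1E². -/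
/-- Error recursion of Newton's iteration: if L(G) = 0 and Z solves the
Sylvester equation (A₁X + A₀ - 1)Z + A₁ZX = L(X), then the new error
E' = G - (X - Z) satisfies (1 - A₀ - A₁X)E' - A₁E'X = A₁E² where E = G - X. -/
theorem stmt17 (R : Type*) [Ring R] (Am1 A0 A1 G X Z : R)
    (hG : A1 * G ^ 2 + (A0 - 1) * G + Am1 = 0)
    (hZ : (A1 * X + A0 - 1) * Z + A1 * Z * X
        = A1 * X ^ 2 + (A0 - 1) * X + Am1) :
    (1 - A0 - A1 * X) * (G - (X - Z)) - A1 * (G - (X - Z)) * X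
      = A1 * (G - X) ^ 2 := by
  linear_combination (norm := noncomm_ring) -hZ - hG
end
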